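/- Let E and F be complex Banach spaces, let T₀ > 0 be a real number, let (λ_j)_{j∈ℕ} and (μ_j)_{j∈ℕ} be strictly increasing sequences of positive real numbers tending to ∞, and let (P_j)_{j∈ℕ} and (Q_j)_{j∈ℕ} be ℓ¹-bounded families of bounded linear operators from E to F such that P_j ≠ 0 and Q_j ≠ 0 for every j. Suppose that for every real t ∈ (0, T₀) one has ∑_{j∈ℕ} e^{-λ_j(T₀-t)} P_j = ∑_{j∈ℕ} e^{-μ_j(T₀-t)} Q_j. Then λ_j = μ_j and P_j = Q_j for every j ∈ ℕ. -/

import Mathlib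

open Filter Topology

/-- An `ℓ¹`-bounded family of operators weighted by scalars tending to `0` is summable in operator
norm. -/
theorem summable_smul_of_tendsto_zero {E F : Type*} [NormedAddCommGroup E] [NormedSpace ℂ E]
    [NormedAddCommGroup F] [NormedSpace ℂ F] [CompleteSpace F] (P : ℕ → E →L[ℂ] F) (C : ℝ)
    (hsum : ∀ x : E, Summable fun j => ‖P j x‖)
    (hbound : ∀ x : E, ∑' j, ‖P j x‖ ≤ C * ‖x‖)
    (c : ℕ → ℂ) (hc : Tendsto c atTop (𝓝 0)) : Summable fun j => c j • P j := by
  rw [summable_iff_vanishing_norm]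
  intro ε hε
  set δ := ε / (2 * (|C| + 1)) with hδ
  have hδpos : 0 < δ := by positivity
  obtain ⟨N, hN⟩ := (Metric.tendsto_atTop.1 hc) δ hδpos
  refine ⟨Finset.range N, fun t ht => ?_⟩
  have hle : ‖∑ j ∈ t, c j • P j‖ ≤ δ * |C| := by
    refine ContinuousLinearMap.opNorm_le_bound _ (by positivity) fun x => ?_
    calc ‖(∑ j ∈ t, c j • P j) x‖ = ‖∑ j ∈ t, c j • P j x‖ := by simp
      _ ≤ ∑ j ∈ t, ‖c j • P j x‖ := norm_sum_le _ _
      _ ≤ ∑ j ∈ t, δ * ‖P j x‖ := by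
        refine Finset.sum_le_sum fun j hj => ?_
        have hjN : N ≤ j := by
          by_contra! h
          exact Finset.disjoint_left.1 ht hj (Finset.mem_range.2 h)
        have hcj := hN j hjN
        rw [dist_zero_right] at hcj
        rw [norm_smul]
        gcongr
      _ = δ * ∑ j ∈ t, ‖P j x‖ := by rw [Finset.mul_sum]
      _ ≤ δ * (|C| * ‖x‖) := by
        gcongr
        exact ((hsum x).sum_le_tsum t fun _ _ => norm_nonneg _).trans
          ((hbound x).trans (by gcongr; exact le_abs_self C))
      _ = δ * |C| * ‖x‖ := by ring
  refine hle.trans_lt ?_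
  calc δ * |C| < δ * (2 * (|C| + 1)) := by gcongr; linarith [abs_nonneg C]
    _ = ε := by rw [hδ]; field_simp

section DirichletSeries

variable {F : Type*} [NormedAddCommGroup F] [NormedSpace ℂ F]

theorem norm_exp_smul_le {l : ℝ} (hl : 0 ≤ l) {z : ℂ} (hz : 0 ≤ z.re) (a : F) :
    ‖Complex.exp (-(l : ℂ) * z) • a‖ ≤ ‖a‖ := by
  rw [norm_smul, Complex.norm_exp]
  refine mul_le_of_le_one_left (norm_nonneg a) (Real.exp_le_one_iff.2 ?_)
  simpa using mul_nonneg hl hz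

variable [CompleteSpace F]

theorem summable_exp_smul {l : ℕ → ℝ} (hl : ∀ j, 0 ≤ l j) {a : ℕ → F}
    (ha : Summable fun j => ‖a j‖) {z : ℂ} (hz : 0 ≤ z.re) :
    Summable fun j => Complex.exp (-(l j : ℂ) * z) • a j :=
  Summable.of_norm_bounded ha fun j => norm_exp_smul_le (hl j) hz (a j)

theorem analyticOnNhd_tsum_exp_smul {l : ℕ → ℝ} (hl : ∀ j, 0 ≤ l j) {a : ℕ → F}
    (ha : Summable fun j => ‖a j‖) :
    AnalyticOnNhd ℂ (fun z => ∑' j, Complex.exp (-(l j : ℂ) * z) • a j) {z : ℂ | 0 < z.re} := by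
  have hopen : IsOpen {z : ℂ | 0 < z.re} := isOpen_lt continuous_const Complex.continuous_re
  refine DifferentiableOn.analyticOnNhd ?_ hopen
  refine Complex.differentiableOn_tsum_of_summable_norm ha (fun j => ?_) hopen fun j z hz =>
    norm_exp_smul_le (hl j) (le_of_lt hz) (a j)
  fun_prop

/-- Two exponential series agreeing on a real interval `(0, T)` agree on the whole right
half-plane. -/
theorem eqOn_tsum_exp_smul {l m : ℕ → ℝ} (hl : ∀ j, 0 ≤ l j) (hm : ∀ j, 0 ≤ m j) {a b : ℕ → F}
    (ha : Summable fun j => ‖a j‖) (hb : Summable fun j => ‖b j‖) {T : ℝ} (hT : 0 < T)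
    (h : ∀ s : ℝ, 0 < s → s < T → ∑' j, Complex.exp (-(l j : ℂ) * s) • a j
      = ∑' j, Complex.exp (-(m j : ℂ) * s) • b j) :
    Set.EqOn (fun z : ℂ => ∑' j, Complex.exp (-(l j : ℂ) * z) • a j)
      (fun z : ℂ => ∑' j, Complex.exp (-(m j : ℂ) * z) • b j) {z : ℂ | 0 < z.re} := by
  refine (analyticOnNhd_tsum_exp_smul hl ha).eqOn_of_preconnected_of_frequently_eq
    (analyticOnNhd_tsum_exp_smul hm hb) (convex_halfSpace_re_gt 0).isPreconnected
    (z₀ := ((T / 2 : ℝ) : ℂ)) (by simpa using hT) ?_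
  have htend : Tendsto (fun s : ℝ => (s : ℂ)) (𝓝[≠] (T / 2)) (𝓝[≠] ((T / 2 : ℝ) : ℂ)) :=
    tendsto_nhdsWithin_of_tendsto_nhds_of_eventually_within _
      Complex.continuous_ofReal.continuousAt.continuousWithinAt.tendsto
      (eventually_nhdsWithin_of_forall fun s hs => Complex.ofReal_injective.ne hs)
  refine htend.frequently (Eventually.frequently ?_)
  have hmem : Set.Ioo 0 T ∈ 𝓝 (T / 2) := Ioo_mem_nhds (by linarith) (by linarith)
  filter_upwards [nhdsWithin_le_nhds hmem] with s hs using h s hs.1 hs.2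

/-- Leading-order behaviour of an exponential series at `+∞`. -/
theorem tendsto_tsum_exp_smul {l : ℕ → ℝ} (hl : StrictMono l) {r : ℝ} (hr : r ≤ l 0) {a : ℕ → F}
    (ha : Summable fun j => ‖a j‖) :
    Tendsto (fun s : ℝ => Complex.exp (r * s) • ∑' j, Complex.exp (-(l j : ℂ) * s) • a j) atTop
      (𝓝 (if l 0 = r then a 0 else 0)) := by
  have hrl : ∀ j, r ≤ l j := fun j => hr.trans (hl.monotone (Nat.zero_le j))
  have hterm : ∀ (s : ℝ) j, Complex.exp (r * s) • Complex.exp (-(l j : ℂ) * s) • a j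
      = Complex.exp (-((l j - r : ℝ) : ℂ) * s) • a j := by
    intro s j
    rw [smul_smul, ← Complex.exp_add]
    congr 2
    push_cast
    ring
  have hlim : (if l 0 = r then a 0 else 0) = ∑' j, if l j = r then a j else 0 := by
    rw [tsum_eq_single 0]
    exact fun j hj => if_neg (hr.trans_lt (hl (Nat.pos_of_ne_zero hj))).ne'
  have hfun : ∀ s : ℝ, Complex.exp (r * s) • ∑' j, Complex.exp (-(l j : ℂ) * s) • a j
      = ∑' j, Complex.exp (-((l j - r : ℝ) : ℂ) * s) • a j := fun s => by
    rw [← tsum_const_smul'']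
    exact tsum_congr (hterm s)
  simp_rw [hfun]
  rw [hlim]
  refine tendsto_tsum_of_dominated_convergence ha (fun j => ?_) ?_
  · split_ifs with h
    · simp [h]
    · have hpos : 0 < l j - r := sub_pos.2 (lt_of_le_of_ne (hrl j) (Ne.symm h))
      rw [tendsto_zero_iff_norm_tendsto_zero]
      simp_rw [norm_smul, Complex.norm_exp]
      have hexp : Tendsto (fun s : ℝ => Real.exp (-((l j - r) * s))) atTop (𝓝 0) :=
        Real.tendsto_exp_neg_atTop_nhds_zero.comp (tendsto_id.const_mul_atTop hpos)
      have hre : ∀ s : ℝ, (-((l j - r : ℝ) : ℂ) * s).re = -((l j - r) * s) := fun s => by simp; ring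
      simp_rw [hre]
      simpa only [zero_mul] using hexp.mul_const ‖a j‖
  · filter_upwards [eventually_ge_atTop 0] with s hs j
    exact norm_exp_smul_le (sub_nonneg.2 (hrl j)) (by simpa using hs) (a j)

end DirichletSeries

section Coefficients

variable {E F : Type*} [NormedAddCommGroup E] [NormedSpace ℂ E]
  [NormedAddCommGroup F] [NormedSpace ℂ F] [CompleteSpace F]

theorem leading_term_eq_of_le {l m : ℕ → ℝ} (hl : StrictMono l) (hm : StrictMono m)
    {P Q : ℕ → E →L[ℂ] F}
    (hP : ∀ x, Summable fun j => ‖P j x‖) (hQ : ∀ x, Summable fun j => ‖Q j x‖)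
    (hP0 : P 0 ≠ 0)
    (h : ∀ x, ∀ s : ℝ, 0 < s → ∑' j, Complex.exp (-(l j : ℂ) * s) • P j x
      = ∑' j, Complex.exp (-(m j : ℂ) * s) • Q j x)
    (hle : l 0 ≤ m 0) : l 0 = m 0 ∧ P 0 = Q 0 := by
  have key : ∀ x, P 0 x = if m 0 = l 0 then Q 0 x else 0 := by
    intro x
    have hPlim := tendsto_tsum_exp_smul hl le_rfl (hP x)
    rw [if_pos rfl] at hPlim
    refine tendsto_nhds_unique hPlim ((tendsto_tsum_exp_smul hm hle (hQ x)).congr' ?_)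
    filter_upwards [eventually_gt_atTop 0] with s hs
    rw [h x s hs]
  by_cases heq : m 0 = l 0
  · exact ⟨heq.symm, ContinuousLinearMap.ext fun x => by simpa [heq] using key x⟩
  · exact absurd (ContinuousLinearMap.ext fun x => by simpa [heq] using key x) hP0

theorem leading_term_eq {l m : ℕ → ℝ} (hl : StrictMono l) (hm : StrictMono m)
    {P Q : ℕ → E →L[ℂ] F}
    (hP : ∀ x, Summable fun j => ‖P j x‖) (hQ : ∀ x, Summable fun j => ‖Q j x‖)
    (hP0 : P 0 ≠ 0) (hQ0 : Q 0 ≠ 0)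
    (h : ∀ x, ∀ s : ℝ, 0 < s → ∑' j, Complex.exp (-(l j : ℂ) * s) • P j x
      = ∑' j, Complex.exp (-(m j : ℂ) * s) • Q j x) : l 0 = m 0 ∧ P 0 = Q 0 := by
  rcases le_total (l 0) (m 0) with hle | hle
  · exact leading_term_eq_of_le hl hm hP hQ hP0 h hle
  · have := leading_term_eq_of_le hm hl hQ hP hQ0 (fun x s hs => (h x s hs).symm) hle
    exact ⟨this.1.symm, this.2.symm⟩

theorem term_eq_of_tsum_exp_smul_eq (n : ℕ) {l m : ℕ → ℝ}
    (hl0 : ∀ j, 0 ≤ l j) (hm0 : ∀ j, 0 ≤ m j) (hl : StrictMono l) (hm : StrictMono m)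
    {P Q : ℕ → E →L[ℂ] F}
    (hP : ∀ x, Summable fun j => ‖P j x‖) (hQ : ∀ x, Summable fun j => ‖Q j x‖)
    (hPne : ∀ j, P j ≠ 0) (hQne : ∀ j, Q j ≠ 0)
    (h : ∀ x, ∀ s : ℝ, 0 < s → ∑' j, Complex.exp (-(l j : ℂ) * s) • P j x
      = ∑' j, Complex.exp (-(m j : ℂ) * s) • Q j x) : l n = m n ∧ P n = Q n := by
  induction n generalizing l m P Q with
  | zero => exact leading_term_eq hl hm hP hQ (hPne 0) (hQne 0) h
  | succ n ih =>
    obtain ⟨hlm, hPQ⟩ := leading_term_eq hl hm hP hQ (hPne 0) (hQne 0) h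
    have hsucc : StrictMono fun j : ℕ => j + 1 := fun _ _ hij => Nat.succ_lt_succ hij
    refine ih (l := fun j => l (j + 1)) (m := fun j => m (j + 1)) (P := fun j => P (j + 1))
      (Q := fun j => Q (j + 1)) (fun j => hl0 _) (fun j => hm0 _) (hl.comp hsucc) (hm.comp hsucc)
      (fun x => (summable_nat_add_iff 1).2 (hP x)) (fun x => (summable_nat_add_iff 1).2 (hQ x))
      (fun j => hPne _) (fun j => hQne _) fun x s hs => ?_
    have hre : 0 ≤ ((s : ℂ)).re := by simpa using hs.le
    have hs' := h x s hs
    rw [(summable_exp_smul hl0 (hP x) hre).tsum_eq_zero_add,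
      (summable_exp_smul hm0 (hQ x) hre).tsum_eq_zero_add, hlm, hPQ] at hs'
    exact add_left_cancel hs'

theorem tsum_exp_smul_apply {l : ℕ → ℝ} (hl : Tendsto l atTop atTop) {P : ℕ → E →L[ℂ] F} {C : ℝ}
    (hsum : ∀ x : E, Summable fun j => ‖P j x‖)
    (hbound : ∀ x : E, ∑' j, ‖P j x‖ ≤ C * ‖x‖) {s : ℝ} (hs : 0 < s) (x : E) :
    (∑' j, Complex.exp (-(l j : ℂ) * s) • P j) x
      = ∑' j, Complex.exp (-(l j : ℂ) * s) • P j x := by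
  have hc : Tendsto (fun j => Complex.exp (-(l j : ℂ) * s)) atTop (𝓝 0) := by
    rw [tendsto_zero_iff_norm_tendsto_zero]
    simp_rw [Complex.norm_exp]
    have hre : ∀ j, (-(l j : ℂ) * s).re = -(l j * s) := fun j => by simp
    simp_rw [hre]
    exact Real.tendsto_exp_neg_atTop_nhds_zero.comp (hl.atTop_mul_const hs)
  exact (ContinuousLinearMap.apply ℂ F x).map_tsum
    (summable_smul_of_tendsto_zero P C hsum hbound _ hc)

end Coefficients

/-- If two exponential operator series, built from strictly
increasing positive sequences tending to `∞` and ℓ¹-bounded families of nonzero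
operators, agree for all real `t ∈ (0, T₀)`, then the exponents and the
operators coincide termwise. -/
theorem stmt_3 {E F : Type*} [NormedAddCommGroup E] [NormedSpace ℂ E]
    [NormedAddCommGroup F] [NormedSpace ℂ F] [CompleteSpace F]
    (T₀ : ℝ) (hT₀ : 0 < T₀)
    (lam mu : ℕ → ℝ) (hlam : ∀ j, 0 < lam j) (hmu : ∀ j, 0 < mu j)
    (hlammono : StrictMono lam) (hmumono : StrictMono mu)
    (hlamlim : Tendsto lam atTop atTop) (hmulim : Tendsto mu atTop atTop)
    (P Q : ℕ → E →L[ℂ] F) (C₁ C₂ : ℝ)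
    (hPsum : ∀ x : E, Summable fun j => ‖P j x‖)
    (hPbound : ∀ x : E, ∑' j, ‖P j x‖ ≤ C₁ * ‖x‖)
    (hQsum : ∀ x : E, Summable fun j => ‖Q j x‖)
    (hQbound : ∀ x : E, ∑' j, ‖Q j x‖ ≤ C₂ * ‖x‖)
    (hPne : ∀ j, P j ≠ 0) (hQne : ∀ j, Q j ≠ 0)
    (heq : ∀ t : ℝ, 0 < t → t < T₀ →
      ∑' j, Complex.exp (-(lam j : ℂ) * ((T₀ : ℂ) - (t : ℂ))) • P j
        = ∑' j, Complex.exp (-(mu j : ℂ) * ((T₀ : ℂ) - (t : ℂ))) • Q j) :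
    ∀ j : ℕ, lam j = mu j ∧ P j = Q j := by
  have hser : ∀ x : E, ∀ s : ℝ, 0 < s → s < T₀ →
      ∑' j, Complex.exp (-(lam j : ℂ) * s) • P j x
        = ∑' j, Complex.exp (-(mu j : ℂ) * s) • Q j x := by
    intro x s hs hsT
    have h := heq (T₀ - s) (by linarith) (by linarith)
    rw [← Complex.ofReal_sub, sub_sub_cancel] at h
    rw [← tsum_exp_smul_apply hlamlim hPsum hPbound hs,
      ← tsum_exp_smul_apply hmulim hQsum hQbound hs, h]
  intro n
  refine term_eq_of_tsum_exp_smul_eq n (fun j => (hlam j).le) (fun j => (hmu j).le) hlammono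
    hmumono hPsum hQsum hPne hQne fun x s hs => ?_
  exact eqOn_tsum_exp_smul (fun j => (hlam j).le) (fun j => (hmu j).le) (hPsum x) (hQsum x) hT₀
    (hser x) (show 0 < ((s : ℂ)).re by simpa using hs)
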